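/- arXiv:2507.07359 — 2 statements merged into one kernel-verified Lean document; each statement's English description precedes it below -/
import Mathlib

section
/- (Variational lower bound, Theorem 1.) Under the stated positivity and normalization assumptions, the variational quantity is a lower bound on the expected information gain: ∑_{(z,h)} p(z,h)·log(q(h,z)/p_Z(z)) ≤ ∑_{(z,h)} p(z,h)·log(p(z|h)/p_Z(z)). -/
open Finset

/-- Variational lower bound (Theorem 1): the variational quantity is a lower bound
on the expected information gain. -/
theorem variational_le_eig
    {Z H : Type*} [Fintype Z] [Fintype H] [Nonempty Z] [Nonempty H]
    (p : Z × H → ℝ) (hp : ∀ zh : Z × H, 0 < p zh) (hpsum : ∑ zh : Z × H, p zh = 1)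
    (q : H → Z → ℝ) (hq : ∀ h z, 0 < q h z) (hqsum : ∀ h, ∑ z, q h z = 1) :
    (∑ zh : Z × H, p zh * Real.log (q zh.2 zh.1 / ∑ h, p (zh.1, h)))
      ≤ ∑ zh : Z × H, p zh *
          Real.log ((p zh / ∑ z, p (z, zh.2)) / ∑ h, p (zh.1, h)) := by
  have hH : ∀ h, 0 < ∑ z, p (z, h) := fun h =>
    Finset.sum_pos (fun z _ => hp (z, h)) Finset.univ_nonempty
  have hZ : ∀ z, 0 < ∑ h, p (z, h) := fun z =>
    Finset.sum_pos (fun h _ => hp (z, h)) Finset.univ_nonempty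
  have key : ∀ zh : Z × H, p zh * Real.log (q zh.2 zh.1 / ∑ h, p (zh.1, h)) ≤
      p zh * Real.log ((p zh / ∑ z, p (z, zh.2)) / ∑ h, p (zh.1, h)) +
        (q zh.2 zh.1 * (∑ z, p (z, zh.2)) - p zh) := by
    intro zh
    have h1 := hp zh
    have h2 := hH zh.2
    have h3 := hZ zh.1
    have h4 := hq zh.2 zh.1
    generalize (∑ z, p (z, zh.2)) = a at *
    generalize (∑ h, p (zh.1, h)) = b at *
    generalize q zh.2 zh.1 = c at *
    generalize p zh = d at *
    have h5 := Real.log_le_sub_one_of_pos (show 0 < c * a / d by positivity)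
    have h6 := mul_le_mul_of_nonneg_left h5 h1.le
    have h7 : d * (c * a / d - 1) = c * a - d := by field_simp
    rw [h7, Real.log_div (by positivity) h1.ne', Real.log_mul h4.ne' h2.ne'] at h6
    rw [Real.log_div h4.ne' h3.ne', Real.log_div (by positivity) h3.ne',
      Real.log_div h1.ne' h2.ne']
    linarith
  have hs : ∑ zh : Z × H, (q zh.2 zh.1 * (∑ z, p (z, zh.2)) - p zh) = 0 := by
    rw [Finset.sum_sub_distrib, Fintype.sum_prod_type_right, sub_eq_zero,
      Fintype.sum_prod_type_right]
    refine Finset.sum_congr rfl fun h _ => ?_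
    simp only []
    rw [← Finset.sum_mul, hqsum, one_mul]
  have := Finset.sum_le_sum (s := Finset.univ) fun zh _ => key zh
  rw [Finset.sum_add_distrib, hs, add_zero] at this
  exact this
end

section
/- (Incremental EIG decomposition of the total EIG, Proposition A.1.) With the notation of the context, the total expected information gain over T experiments equals the expectation over full trajectories of the sum of incremental expected information gains: ∑_{m, h, z} pM(m) · (∏_{t<T} ℓ_t(m, h|_t, h(t))) · pZ(m, z) · log( p(z | h) / p₀(z) ) = ∑_h p_T(h) · ∑_{t=0}^{T-1} I_{t+1}(h|_t), where p₀(z) = ∑_m pM(m)·pZ(m,z) is the prior predictive distribution of the query. -/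
open Finset

/-- Trajectory weight `w_t(m, h') = pM(m) · ∏_{τ<t} ℓ_τ(m, h'|_τ, h'(τ))`. -/
noncomputable def trajWeight {M X : Type*} [Fintype X]
    (pM : M → ℝ) (ℓ : (t : ℕ) → M → (Fin t → X) → X → ℝ)
    {t : ℕ} (m : M) (h : Fin t → X) : ℝ :=
  pM m * ∏ τ : Fin t, ℓ τ m (fun i => h (Fin.castLE τ.isLt.le i)) (h τ)

/-- History marginal `p_t(h') = ∑_m w_t(m, h')`. -/
noncomputable def histMarg {M X : Type*} [Fintype M] [Fintype X]
    (pM : M → ℝ) (ℓ : (t : ℕ) → M → (Fin t → X) → X → ℝ)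
    {t : ℕ} (h : Fin t → X) : ℝ :=
  ∑ m, trajWeight pM ℓ m h

/-- Posterior-predictive `p(z | h') = (∑_m w_t(m,h')·pZ(m,z)) / p_t(h')`. -/
noncomputable def postPred {M Z X : Type*} [Fintype M] [Fintype X]
    (pM : M → ℝ) (pZ : M → Z → ℝ) (ℓ : (t : ℕ) → M → (Fin t → X) → X → ℝ)
    {t : ℕ} (h : Fin t → X) (z : Z) : ℝ :=
  (∑ m, trajWeight pM ℓ m h * pZ m z) / histMarg pM ℓ h

/-- Incremental expected information gain
`I_{t+1}(h') = ∑_{m,x,z} (w_t(m,h')/p_t(h')) · ℓ_t(m,h',x) · pZ(m,z) ·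
  log( p(z | h'⌢x) / p(z | h') )`. -/
noncomputable def incEIG {M Z X : Type*} [Fintype M] [Fintype Z] [Fintype X]
    (pM : M → ℝ) (pZ : M → Z → ℝ) (ℓ : (t : ℕ) → M → (Fin t → X) → X → ℝ)
    {t : ℕ} (h : Fin t → X) : ℝ :=
  ∑ m, ∑ x, ∑ z,
    (trajWeight pM ℓ m h / histMarg pM ℓ h) * ℓ t m h x * pZ m z *
      Real.log (postPred pM pZ ℓ (Fin.snoc h x) z / postPred pM pZ ℓ h z)

lemma aux_sum_snoc {X : Type*} [Fintype X] (n : ℕ) (f : (Fin (n+1) → X) → ℝ) :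
    ∑ h, f h = ∑ h : Fin n → X, ∑ x, f (Fin.snoc h x) := by
  rw [← (Fin.snocEquiv (fun _ : Fin (n+1) => X)).sum_comp f, Fintype.sum_prod_type,
    Finset.sum_comm]
  rfl

lemma aux_restr {X : Type*} {n t : ℕ} (h : Fin n → X) (x : X) (ht : t ≤ n) (ht' : t ≤ n + 1) :
    (fun i : Fin t => (Fin.snoc h x : Fin (n+1) → X) (Fin.castLE ht' i))
      = fun i : Fin t => h (Fin.castLE ht i) := by
  funext i
  have : Fin.castLE ht' i = Fin.castSucc (Fin.castLE ht i) := rfl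
  rw [this, Fin.snoc_castSucc]

lemma aux_traj_snoc {M X : Type*} [Fintype X]
    (pM : M → ℝ) (ℓ : (t : ℕ) → M → (Fin t → X) → X → ℝ)
    {t : ℕ} (m : M) (h : Fin t → X) (x : X) :
    trajWeight pM ℓ m (Fin.snoc h x : Fin (t+1) → X) = trajWeight pM ℓ m h * ℓ t m h x := by
  unfold trajWeight
  rw [Fin.prod_univ_castSucc, ← mul_assoc]
  congr 1
  · congr 1
    refine Finset.prod_congr rfl fun τ _ => ?_
    rw [Fin.snoc_castSucc]
    exact congrArg (fun g => ℓ τ m g (h τ)) (aux_restr h x τ.isLt.le _)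
  · rw [Fin.snoc_last]
    exact congrArg (fun g => ℓ t m g x) (aux_restr h x le_rfl _)

lemma aux_traj_pos {M X : Type*} [Fintype X]
    (pM : M → ℝ) (hpM : ∀ m, 0 < pM m) (ℓ : (t : ℕ) → M → (Fin t → X) → X → ℝ)
    {T : ℕ} (hℓ : ∀ t, t < T → ∀ (m : M) (h : Fin t → X) (x : X), 0 < ℓ t m h x)
    (m : M) (h : Fin T → X) : 0 < trajWeight pM ℓ m h :=
  mul_pos (hpM m) (Finset.prod_pos fun τ _ => hℓ τ τ.isLt _ _ _)

lemma aux_hist_pos {M X : Type*} [Fintype M] [Nonempty M] [Fintype X]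
    (pM : M → ℝ) (hpM : ∀ m, 0 < pM m) (ℓ : (t : ℕ) → M → (Fin t → X) → X → ℝ)
    {T : ℕ} (hℓ : ∀ t, t < T → ∀ (m : M) (h : Fin t → X) (x : X), 0 < ℓ t m h x)
    (h : Fin T → X) : 0 < histMarg pM ℓ h :=
  Finset.sum_pos (fun m _ => aux_traj_pos pM hpM ℓ hℓ m h) Finset.univ_nonempty

lemma aux_post_pos {M Z X : Type*} [Fintype M] [Nonempty M] [Fintype X]
    (pM : M → ℝ) (hpM : ∀ m, 0 < pM m) (pZ : M → Z → ℝ) (hpZ : ∀ m z, 0 < pZ m z)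
    (ℓ : (t : ℕ) → M → (Fin t → X) → X → ℝ)
    {T : ℕ} (hℓ : ∀ t, t < T → ∀ (m : M) (h : Fin t → X) (x : X), 0 < ℓ t m h x)
    (h : Fin T → X) (z : Z) : 0 < postPred pM pZ ℓ h z :=
  div_pos (Finset.sum_pos (fun m _ => mul_pos (aux_traj_pos pM hpM ℓ hℓ m h) (hpZ m z))
    Finset.univ_nonempty) (aux_hist_pos pM hpM ℓ hℓ h)

lemma aux_main {M Z X : Type*} [Fintype M] [Fintype Z] [Fintype X] [Nonempty M]
    (pM : M → ℝ) (hpM : ∀ m, 0 < pM m) (hpMsum : ∑ m, pM m = 1)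
    (pZ : M → Z → ℝ) (hpZ : ∀ m z, 0 < pZ m z)
    (ℓ : (t : ℕ) → M → (Fin t → X) → X → ℝ) (T : ℕ)
    (hℓ : ∀ t, t < T → ∀ (m : M) (h : Fin t → X) (x : X), 0 < ℓ t m h x)
    (hℓsum : ∀ t, t < T → ∀ (m : M) (h : Fin t → X), ∑ x, ℓ t m h x = 1) :
    (∑ h : Fin T → X, ∑ m : M, ∑ z : Z, trajWeight pM ℓ m h * pZ m z *
          Real.log (postPred pM pZ ℓ h z / ∑ m', pM m' * pZ m' z))
      = ∑ h : Fin T → X, histMarg pM ℓ h *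
          ∑ t : Fin T, incEIG pM pZ ℓ (fun i : Fin t => h (Fin.castLE t.isLt.le i)) := by
  induction T with
  | zero =>
    have hp : ∀ (h : Fin 0 → X) (z : Z), postPred pM pZ ℓ h z = ∑ m', pM m' * pZ m' z := by
      intro h z
      simp [postPred, histMarg, trajWeight, hpMsum]
    have h0 : ∀ z, Real.log ((∑ m', pM m' * pZ m' z) / ∑ m', pM m' * pZ m' z) = 0 := by
      intro z
      rw [div_self, Real.log_one]
      exact (Finset.sum_pos (fun m _ => mul_pos (hpM m) (hpZ m z)) Finset.univ_nonempty).ne'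
    simp only [hp, h0]
    simp
  | succ n ih =>
    have hℓ' := fun t (ht : t < n) => hℓ t (Nat.lt_succ_of_lt ht)
    have ih := ih hℓ' (fun t ht => hℓsum t (Nat.lt_succ_of_lt ht))
    rw [aux_sum_snoc, aux_sum_snoc]
    have hmarg : ∀ h : Fin n → X,
        ∑ x, histMarg pM ℓ (Fin.snoc h x : Fin (n+1) → X) = histMarg pM ℓ h := by
      intro h
      simp only [histMarg, aux_traj_snoc]
      rw [Finset.sum_comm]
      simp only [← Finset.mul_sum, hℓsum n (Nat.lt_succ_self n), mul_one]
    have hR : ∀ (h : Fin n → X) (x : X),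
        (∑ t : Fin (n+1), incEIG pM pZ ℓ
          (fun i : Fin t => (Fin.snoc h x : Fin (n+1) → X) (Fin.castLE t.isLt.le i)))
        = (∑ t : Fin n, incEIG pM pZ ℓ (fun i : Fin t => h (Fin.castLE t.isLt.le i)))
          + incEIG pM pZ ℓ h := by
      intro h x
      rw [Fin.sum_univ_castSucc]
      congr 1
      · exact Finset.sum_congr rfl fun τ _ =>
          congrArg (fun g : Fin τ → X => incEIG pM pZ ℓ g) (aux_restr h x τ.isLt.le _)
      · exact congrArg (fun g : Fin n → X => incEIG pM pZ ℓ g) (aux_restr h x le_rfl _)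
    simp only [hR, ← Finset.sum_mul, hmarg]
    simp only [mul_add]
    rw [Finset.sum_add_distrib, ← ih, ← Finset.sum_add_distrib]
    refine Finset.sum_congr rfl fun h _ => ?_
    have hI : histMarg pM ℓ h * incEIG pM pZ ℓ h = ∑ m, ∑ z, ∑ x,
        trajWeight pM ℓ m h * ℓ n m h x * pZ m z *
        Real.log (postPred pM pZ ℓ (Fin.snoc h x : Fin (n+1) → X) z / postPred pM pZ ℓ h z) := by
      have hne := (aux_hist_pos pM hpM ℓ hℓ' h).ne'
      unfold incEIG
      simp only [Finset.mul_sum]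
      refine Finset.sum_congr rfl fun m _ => ?_
      rw [Finset.sum_comm]
      refine Finset.sum_congr rfl fun z _ => Finset.sum_congr rfl fun x _ => ?_
      field_simp
    rw [hI, Finset.sum_comm, ← Finset.sum_add_distrib]
    refine Finset.sum_congr rfl fun m _ => ?_
    rw [Finset.sum_comm, ← Finset.sum_add_distrib]
    refine Finset.sum_congr rfl fun z _ => ?_
    have h1 : trajWeight pM ℓ m h * pZ m z *
          Real.log (postPred pM pZ ℓ h z / ∑ m', pM m' * pZ m' z)
        = ∑ x, ℓ n m h x * (trajWeight pM ℓ m h * pZ m z *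
          Real.log (postPred pM pZ ℓ h z / ∑ m', pM m' * pZ m' z)) := by
      rw [← Finset.sum_mul, hℓsum n (Nat.lt_succ_self n), one_mul]
    rw [h1, ← Finset.sum_add_distrib]
    refine Finset.sum_congr rfl fun x _ => ?_
    have hz : (∑ m', pM m' * pZ m' z) ≠ 0 :=
      (Finset.sum_pos (fun m _ => mul_pos (hpM m) (hpZ m z)) Finset.univ_nonempty).ne'
    have ha := (aux_post_pos pM hpM pZ hpZ ℓ hℓ' h z).ne'
    have hb := (aux_post_pos pM hpM pZ hpZ ℓ hℓ (Fin.snoc h x : Fin (n+1) → X) z).ne'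
    rw [aux_traj_snoc, Real.log_div hb hz, Real.log_div ha hz, Real.log_div hb ha]
    ring

/-- Incremental EIG decomposition of the total EIG (Proposition A.1): the total expected
information gain over `T` experiments equals the expectation over full trajectories of
the sum of incremental expected information gains. -/
theorem total_eig_eq_expected_sum_incremental_eig
    {M Z X : Type*} [Fintype M] [Fintype Z] [Fintype X]
    [Nonempty M] [Nonempty Z] [Nonempty X]
    (T : ℕ) (hT : 0 < T)
    (pM : M → ℝ) (hpM : ∀ m, 0 < pM m) (hpMsum : ∑ m, pM m = 1)
    (pZ : M → Z → ℝ) (hpZ : ∀ m z, 0 < pZ m z) (hpZsum : ∀ m, ∑ z, pZ m z = 1)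
    (ℓ : (t : ℕ) → M → (Fin t → X) → X → ℝ)
    (hℓ : ∀ t, t < T → ∀ (m : M) (h : Fin t → X) (x : X), 0 < ℓ t m h x)
    (hℓsum : ∀ t, t < T → ∀ (m : M) (h : Fin t → X), ∑ x, ℓ t m h x = 1) :
    (∑ m : M, ∑ h : Fin T → X, ∑ z : Z,
        pM m * (∏ t : Fin T, ℓ t m (fun i => h (Fin.castLE t.isLt.le i)) (h t)) * pZ m z *
          Real.log (postPred pM pZ ℓ h z / ∑ m', pM m' * pZ m' z))
      = ∑ h : Fin T → X, histMarg pM ℓ h *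
          ∑ t : Fin T, incEIG pM pZ ℓ (fun i : Fin t => h (Fin.castLE t.isLt.le i)) := by
  rw [Finset.sum_comm]
  exact aux_main pM hpM hpMsum pZ hpZ ℓ T hℓ hℓsum
end
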